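/- (Theorem 3.1) RTP does not imply RTINIP: there exists a compilation chain (i.e., types of source partial programs, source contexts and target contexts, with source and target semantics over traces whose events are triples of a direction, a security level, and a natural-number value) that satisfies RTP but does not satisfy RTINIP, the robust preservation of the single hyperproperty TINI. -/

import Mathlib

/-- Concrete trace model: a trace is either a terminated trace (finite list of
events) or an infinite stream of events. -/
inductive Trc (E : Type) : Type where
  | term : List E → Trc E
  | inf  : (Nat → E) → Trc E

/-- Direction of an event: input or output. -/
inductive Dir : Type where
  | input : Dir
  | output : Dir
deriving DecidableEq

/-- Security level of an event: public or secret. -/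
inductive Lvl : Type where
  | pub : Lvl
  | sec : Lvl
deriving DecidableEq

/-- Events: a direction, a security level, and a natural-number value. -/
abbrev Ev : Type := Dir × Lvl × ℕ

/-- The sublist of public input events. -/
def pubInputs (l : List Ev) : List Ev :=
  l.filter fun e => decide (e.1 = Dir.input ∧ e.2.1 = Lvl.pub)

/-- The sublist of public events. -/
def pubEvents (l : List Ev) : List Ev :=
  l.filter fun e => decide (e.2.1 = Lvl.pub)

/-- Termination-insensitive noninterference. -/
def TINI : Set (Set (Trc Ev)) :=
  { b | ∀ l1 l2 : List Ev, Trc.term l1 ∈ b → Trc.term l2 ∈ b →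
        pubInputs l1 = pubInputs l2 → pubEvents l1 = pubEvents l2 }

/-- Robust Trace Property Preservation. -/
def RTP {Prog CtxS CtxT : Type}
    (semS : CtxS → Prog → Trc Ev → Prop)
    (semT : CtxT → Prog → Trc Ev → Prop) : Prop :=
  ∀ (π : Set (Trc Ev)) (P : Prog),
    (∀ (Cs : CtxS) (t : Trc Ev), semS Cs P t → t ∈ π) →
    (∀ (Ct : CtxT) (t : Trc Ev), semT Ct P t → t ∈ π)

/-- Robust preservation of the single hyperproperty TINI. -/
def RTINIP {Prog CtxS CtxT : Type}
    (semS : CtxS → Prog → Trc Ev → Prop)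
    (semT : CtxT → Prog → Trc Ev → Prop) : Prop :=
  ∀ P : Prog,
    (∀ Cs : CtxS, {t | semS Cs P t} ∈ TINI) →
    (∀ Ct : CtxT, {t | semT Ct P t} ∈ TINI)

/-- Theorem 3.1: RTP does not imply RTINIP. -/
theorem rtp_not_implies_rtinip :
    ∃ (Prog CtxS CtxT : Type)
      (semS : CtxS → Prog → Trc Ev → Prop)
      (semT : CtxT → Prog → Trc Ev → Prop),
      RTP semS semT ∧ ¬ RTINIP semS semT := by
  refine ⟨Unit, ℕ, Unit, fun n _ t => t = .term [(.output, .pub, n)],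
    fun _ _ t => ∃ n, t = .term [(.output, .pub, n)], ?_, fun h => ?_⟩
  · rintro π P hS - t ⟨n, ht⟩
    exact hS n t ht
  · have source_mem (n : ℕ) :
        {t | t = Trc.term [((Dir.output, Lvl.pub, n) : Ev)]} ∈ TINI := by
      rintro l1 l2 h1 h2 -
      rw [Trc.term.inj h1, Trc.term.inj h2]
    have outputs_eq := h () source_mem () [(.output, .pub, 0)] [(.output, .pub, 1)]
      ⟨0, rfl⟩ ⟨1, rfl⟩ rfl
    simp [pubEvents] at outputs_eq
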